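/- Let t be a natural number with 2t ≤ n, let C = {0,1}^n, let ℓ be the function on C defined by ℓ(x) = t − (x_1+…+x_n), and let f : C → ℝ be invariant under all permutations of the coordinates, with deg_C(f) ≤ t. Suppose ℓ properly divides f to odd order, i.e., there exists an odd natural number c such that ℓ^c properly divides f but ℓ^{c+1} does not. Then for all natural numbers d_1 and d_2 with 2d_1 ≤ n − deg_C(f), d_1 ≤ t, and d_2 ≤ t, the function f is not (d_1,d_2)-rsos on C: there is no function h : C → ℝ that is d_1-sos on C and not identically zero on C such that f·h is d_2-sos on C. -/

import Mathlib

/-- The hypercube `{0,1}^n ⊆ ℝ^n`. -/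
def cube (n : ℕ) : Set (Fin n → ℝ) := {x | ∀ i, x i = 0 ∨ x i = 1}

/-- `f` is `k`-sos on `X`: a finite sum of squares of polynomials of total degree ≤ `k`,
as a function on `X`. -/
def IsSosOn (n : ℕ) (X : Set (Fin n → ℝ)) (k : ℕ) (f : (Fin n → ℝ) → ℝ) : Prop :=
  ∃ (m : ℕ) (g : Fin m → MvPolynomial (Fin n) ℝ),
    (∀ i, (g i).totalDegree ≤ k) ∧ ∀ x ∈ X, f x = ∑ i, (MvPolynomial.eval x (g i)) ^ 2

/-- The degree of `f` as a function on `X`: the minimal total degree of a polynomial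
restricting to `f` on `X`. -/
noncomputable def degOn (n : ℕ) (X : Set (Fin n → ℝ)) (f : (Fin n → ℝ) → ℝ) : ℕ :=
  sInf {d | ∃ p : MvPolynomial (Fin n) ℝ, p.totalDegree ≤ d ∧
    ∀ x ∈ X, MvPolynomial.eval x p = f x}

/-- `g` properly divides `f` on `X`: `f = g·h` on `X` with `deg f = deg g + deg h`. -/
def ProperlyDividesOn (n : ℕ) (X : Set (Fin n → ℝ)) (g f : (Fin n → ℝ) → ℝ) : Prop :=
  ∃ h : (Fin n → ℝ) → ℝ, (∀ x ∈ X, f x = g x * h x) ∧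
    degOn n X f = degOn n X g + degOn n X h

/-- `f` is invariant under all permutations of coordinates, as a function on `X`. -/
def SymmOn (n : ℕ) (X : Set (Fin n → ℝ)) (f : (Fin n → ℝ) → ℝ) : Prop :=
  ∀ σ : Equiv.Perm (Fin n), ∀ x ∈ X, f (fun i => x (σ i)) = f x

open Finset Polynomial

section InclusionMatrix

variable {α : Type*} [DecidableEq α]

lemma sum_powersetCard_succ_insert {v : α} {T : Finset α} (hv : v ∉ T) (d : ℕ)
    (a : Finset α → ℝ) :
    ∑ S ∈ powersetCard (d + 1) (insert v T), a S =
      ∑ S ∈ powersetCard (d + 1) T, a S + ∑ S ∈ powersetCard d T, a (insert v S) := by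
  have hmem : ∀ S ∈ powersetCard d T, v ∉ S := fun S hS hvS =>
    hv ((mem_powersetCard.1 hS).1 hvS)
  rw [powersetCard_succ_insert hv, sum_union, sum_image]
  · intro S hS S' hS' h
    rw [← erase_insert (hmem S hS), ← erase_insert (hmem S' hS')]
    exact congrArg (fun U => U.erase v) h
  · rw [disjoint_left]
    intro S hS hS'
    obtain ⟨U, -, rfl⟩ := mem_image.1 hS'
    exact hv ((mem_powersetCard.1 hS).1 (mem_insert_self v U))

/-- A function on `d`-sets that is invariant under exchanging one element is constant. -/
lemma eq_of_exchange (d : ℕ) (V : Finset α) (a : Finset α → ℝ)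
    (hex : ∀ v ∈ V, ∀ w ∈ V, v ≠ w → ∀ S ∈ powersetCard d (V \ {v, w}),
      a (insert v S) = a (insert w S)) :
    ∀ m : ℕ, ∀ S ∈ powersetCard (d + 1) V, ∀ S' ∈ powersetCard (d + 1) V,
      #(S \ S') = m → a S = a S' := by
  intro m
  induction m with
  | zero =>
    intro S hS S' hS' h
    have hsub : S ⊆ S' := sdiff_eq_empty_iff_subset.1 (card_eq_zero.1 h)
    rw [eq_of_subset_of_card_le hsub
      ((mem_powersetCard.1 hS').2.trans (mem_powersetCard.1 hS).2.symm).le]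
  | succ m ih =>
    intro S hS S' hS' h
    obtain ⟨hSV, hSc⟩ := mem_powersetCard.1 hS
    obtain ⟨hSV', hSc'⟩ := mem_powersetCard.1 hS'
    have h' : #(S' \ S) = m + 1 := by
      rw [← h]; exact card_sdiff_comm (hSc'.trans hSc.symm)
    obtain ⟨v, hv⟩ := card_pos.1 (by omega : 0 < #(S \ S'))
    obtain ⟨w, hw⟩ := card_pos.1 (by omega : 0 < #(S' \ S))
    rw [mem_sdiff] at hv hw
    have hvw : v ≠ w := fun e => hw.2 (e ▸ hv.1)
    have hwe : w ∉ S.erase v := fun hh => hw.2 (mem_of_mem_erase hh)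
    have hce : #(S.erase v) = d := by rw [card_erase_of_mem hv.1]; omega
    have h1 := hex v (hSV hv.1) w (hSV' hw.1) hvw (S.erase v) (mem_powersetCard.2
      ⟨fun x hx => by
        have := hSV (mem_of_mem_erase hx)
        have hxv := ne_of_mem_erase hx
        have hxw : x ≠ w := fun e => hwe (e ▸ hx)
        simp [this, hxv, hxw], hce⟩)
    rw [insert_erase hv.1] at h1
    rw [h1]
    refine ih _ (mem_powersetCard.2 ⟨?_, ?_⟩) S' hS' ?_
    · exact insert_subset (hSV' hw.1) ((erase_subset _ _).trans hSV)
    · rw [card_insert_of_notMem hwe, hce]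
    · rw [insert_sdiff_of_mem _ hw.1, erase_sdiff_comm, card_erase_of_mem (mem_sdiff.2 hv), h]
      rfl

/-- Injectivity of the inclusion matrix of `d`-sets versus `t`-sets. -/
lemma eq_zero_of_sum_powersetCard_eq_zero (d : ℕ) :
    ∀ (t : ℕ) (V : Finset α) (a : Finset α → ℝ), d ≤ t → t + d ≤ #V →
      (∀ T ∈ powersetCard t V, ∑ S ∈ powersetCard d T, a S = 0) →
      ∀ S ∈ powersetCard d V, a S = 0 := by
  induction d with
  | zero =>
    intro t V a _ hV h S hS
    obtain ⟨T, hTV, hT⟩ := exists_subset_card_eq (show t ≤ #V by omega)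
    have := h T (mem_powersetCard.2 ⟨hTV, hT⟩)
    simp only [powersetCard_zero, sum_singleton, mem_singleton] at this hS
    rw [hS, this]
  | succ d ih =>
    intro t V a hdt hV h S hS
    obtain ⟨t, rfl⟩ : ∃ t', t = t' + 1 := ⟨t - 1, by omega⟩
    have hex : ∀ v ∈ V, ∀ w ∈ V, v ≠ w → ∀ S ∈ powersetCard d (V \ {v, w}),
        a (insert v S) = a (insert w S) := by
      intro v hv w hw hvw S hS
      rw [← sub_eq_zero]
      refine ih t (V \ {v, w}) (fun S => a (insert v S) - a (insert w S)) (by omega) ?_ ?_ S hS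
      · rw [card_sdiff_of_subset (by simp [insert_subset_iff, hv, hw]), card_pair hvw]
        omega
      · intro T hT
        obtain ⟨hTV, hTc⟩ := mem_powersetCard.1 hT
        have hvT : v ∉ T := fun hh => by simpa using hTV hh
        have hwT : w ∉ T := fun hh => by simpa using hTV hh
        have hTV' := hTV.trans sdiff_subset
        have e1 := h (insert v T) (mem_powersetCard.2
          ⟨insert_subset hv hTV', by rw [card_insert_of_notMem hvT, hTc]⟩)
        have e2 := h (insert w T) (mem_powersetCard.2
          ⟨insert_subset hw hTV', by rw [card_insert_of_notMem hwT, hTc]⟩)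
        rw [sum_powersetCard_succ_insert hvT] at e1
        rw [sum_powersetCard_succ_insert hwT] at e2
        rw [sum_sub_distrib]
        linarith
    obtain ⟨hSV, hSc⟩ := mem_powersetCard.1 hS
    obtain ⟨T, hST, hTV, hTc⟩ := exists_subsuperset_card_eq hSV
      (show #S ≤ t + 1 by omega) (by omega)
    have h0 := h T (mem_powersetCard.2 ⟨hTV, hTc⟩)
    rw [sum_congr rfl (fun S' hS' => eq_of_exchange d V a hex _ S'
      (powersetCard_mono hTV hS') S hS rfl), sum_const, card_powersetCard, hTc, nsmul_eq_mul] at h0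
    have := Nat.choose_pos hdt
    exact (mul_eq_zero.1 h0).resolve_left (by positivity)

end InclusionMatrix

section Cube

variable {n : ℕ}

/-- The indicator vector of a set of coordinates. -/
def cubePoint (T : Finset (Fin n)) : Fin n → ℝ := fun i => if i ∈ T then 1 else 0

lemma cubePoint_mem_cube (T : Finset (Fin n)) : cubePoint T ∈ cube n := fun i => by
  by_cases h : i ∈ T <;> simp [cubePoint, h]

lemma exists_eq_cubePoint {x : Fin n → ℝ} (hx : x ∈ cube n) : ∃ T, x = cubePoint T := by
  classical
  refine ⟨univ.filter (fun i => x i = 1), funext fun i => ?_⟩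
  rcases hx i with h | h <;> simp [cubePoint, h]

lemma sum_cubePoint (T : Finset (Fin n)) : ∑ i, cubePoint T i = (#T : ℝ) := by
  simp [cubePoint]

lemma prod_cubePoint (S T : Finset (Fin n)) :
    ∏ i ∈ S, cubePoint T i = if S ⊆ T then 1 else 0 := by
  simp [cubePoint, prod_ite_zero, subset_iff]

lemma eval_cubePoint (T : Finset (Fin n)) (p : MvPolynomial (Fin n) ℝ) :
    MvPolynomial.eval (cubePoint T) p =
      ∑ m ∈ p.support, p.coeff m * if m.support ⊆ T then 1 else 0 := by
  rw [MvPolynomial.eval_eq]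
  refine sum_congr rfl fun m _ => ?_
  rw [← prod_cubePoint]
  congr 1
  refine prod_congr rfl fun i hi => ?_
  have := Finsupp.mem_support_iff.1 hi
  by_cases h : i ∈ T <;> simp [cubePoint, h, this]

lemma card_support_le_totalDegree {p : MvPolynomial (Fin n) ℝ} {m : Fin n →₀ ℕ}
    (hm : m ∈ p.support) : #m.support ≤ p.totalDegree := by
  refine le_trans ?_ (MvPolynomial.le_totalDegree hm)
  rw [card_eq_sum_ones, Finsupp.sum]
  exact sum_le_sum fun i hi => Nat.one_le_iff_ne_zero.2 (Finsupp.mem_support_iff.1 hi)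

lemma sum_powersetCard_ite_subset (S : Finset (Fin n)) (k : ℕ) :
    ((n.choose #S : ℕ) : ℝ) * ∑ T ∈ powersetCard k univ, (if S ⊆ T then (1 : ℝ) else 0) =
      n.choose k * k.choose #S := by
  rw [← Finset.sum_filter, sum_const, nsmul_eq_mul, mul_one]
  norm_cast
  by_cases h : #S ≤ k
  · rw [card_filter_powersetCard_subset _ _ _ (subset_univ S) h, card_univ, Fintype.card_fin,
      Nat.choose_mul h]
  · rw [Nat.choose_eq_zero_of_lt (not_le.1 h), mul_zero, mul_eq_zero, card_eq_zero]
    right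
    refine filter_eq_empty_iff.2 fun T hT hST => h ?_
    rw [← (mem_powersetCard.1 hT).2]
    exact card_le_card hST

/-- The average of a polynomial over the levels of the cube is polynomial in the level. -/
lemma exists_levelMean (p : MvPolynomial (Fin n) ℝ) :
    ∃ P : ℝ[X], P.natDegree ≤ p.totalDegree ∧ ∀ k : ℕ,
      ∑ T ∈ powersetCard k univ, MvPolynomial.eval (cubePoint T) p =
        n.choose k * P.eval (k : ℝ) := by
  refine ⟨∑ m ∈ p.support, C (p.coeff m / n.choose #m.support / (#m.support).factorial) *
    descPochhammer ℝ #m.support, ?_, fun k => ?_⟩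
  · refine natDegree_sum_le_of_forall_le _ _ fun m hm => ?_
    refine (natDegree_C_mul_le _ _).trans ?_
    rw [descPochhammer_natDegree]
    exact card_support_le_totalDegree hm
  · simp only [eval_cubePoint]
    rw [sum_comm, eval_finsetSum, mul_sum]
    refine sum_congr rfl fun m _ => ?_
    rw [← mul_sum, eval_mul, eval_C, descPochhammer_eval_eq_descFactorial,
      Nat.descFactorial_eq_factorial_mul_choose]
    have h := sum_powersetCard_ite_subset m.support k
    have h1 : ((n.choose #m.support : ℕ) : ℝ) ≠ 0 := by
      have := Nat.choose_pos (card_finset_fin_le m.support)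
      positivity
    have h2 : ((#m.support).factorial : ℝ) ≠ 0 := by positivity
    push_cast
    field_simp
    linear_combination (p.coeff m) * h

lemma eq_of_eval_levels {P Q : ℝ[X]} (hP : P.natDegree ≤ n) (hQ : Q.natDegree ≤ n)
    (h : ∀ k ≤ n, P.eval (k : ℝ) = Q.eval (k : ℝ)) : P = Q :=
  eq_of_natDegree_lt_card_of_eval_eq P Q (f := fun i : Fin (n + 1) => ((i : ℕ) : ℝ))
    (fun i j hij => Fin.ext (Nat.cast_injective hij)) (fun i => h i (Nat.lt_succ_iff.1 i.2))
    (by simpa using ⟨by omega, by omega⟩)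

lemma totalDegree_prod_X_le (S : Finset (Fin n)) :
    (∏ i ∈ S, (MvPolynomial.X i : MvPolynomial (Fin n) ℝ)).totalDegree ≤ #S := by
  refine (MvPolynomial.totalDegree_finsetProd _ _).trans ?_
  simp

lemma eval_prod_X_cubePoint (S T : Finset (Fin n)) :
    MvPolynomial.eval (cubePoint T) (∏ i ∈ S, (MvPolynomial.X i : MvPolynomial (Fin n) ℝ)) =
      if S ⊆ T then 1 else 0 := by
  rw [map_prod]
  simp only [MvPolynomial.eval_X]
  exact prod_cubePoint S T

/-- `φ` agrees on the cube, up to a multiple of `t - ∑ xᵢ` with cofactor of degree at most `d`,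
with a homogeneous multilinear form of degree `d + 1`. -/
def HasLevelReduction (t d : ℕ) (φ : Finset (Fin n) → ℝ) : Prop :=
  ∃ (q : MvPolynomial (Fin n) ℝ) (b : Finset (Fin n) → ℝ), q.totalDegree ≤ d ∧
    ∀ T, φ T = ((t : ℝ) - #T) * MvPolynomial.eval (cubePoint T) q +
      ∑ S ∈ powersetCard (d + 1) T, b S

lemma HasLevelReduction.sum {ι : Type*} {t d : ℕ} (s : Finset ι) (a : ι → ℝ)
    (φ : ι → Finset (Fin n) → ℝ) (h : ∀ i ∈ s, HasLevelReduction t d (φ i)) :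
    HasLevelReduction t d (fun T => ∑ i ∈ s, a i * φ i T) := by
  choose! q b hq hb using h
  refine ⟨∑ i ∈ s, MvPolynomial.C (a i) * q i, fun S => ∑ i ∈ s, a i * b i S,
    MvPolynomial.totalDegree_finsetSum_le fun i hi => ?_, fun T => ?_⟩
  · refine (MvPolynomial.totalDegree_mul _ _).trans ?_
    rw [MvPolynomial.totalDegree_C, zero_add]
    exact hq i hi
  · rw [sum_comm, map_sum, mul_sum, ← sum_add_distrib]
    refine sum_congr rfl fun i hi => ?_
    rw [hb i hi T, map_mul, MvPolynomial.eval_C, ← mul_sum]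
    ring

lemma hasLevelReduction_squarefree {t d : ℕ} (hdt : d + 1 ≤ t) (j : ℕ) :
    ∀ S : Finset (Fin n), #S + j = d + 1 →
      HasLevelReduction t d (fun T => if S ⊆ T then (1 : ℝ) else 0) := by
  induction j with
  | zero =>
    intro S hS
    refine ⟨0, fun S' => if S' = S then 1 else 0, by simp, fun T => ?_⟩
    rw [map_zero, mul_zero, zero_add, sum_ite_eq' (powersetCard (d + 1) T) S (fun _ => (1 : ℝ))]
    have : #S = d + 1 := by omega
    simp [mem_powersetCard, this]
  | succ j ih =>
    intro S hS
    have hne : (t : ℝ) - #S ≠ 0 := by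
      have : (#S : ℝ) < t := by exact_mod_cast (by omega : #S < t)
      exact (sub_pos.2 this).ne'
    obtain ⟨q, b, hq, hb⟩ := HasLevelReduction.sum Sᶜ (fun _ => ((t : ℝ) - #S)⁻¹)
      (fun i T => if insert i S ⊆ T then (1 : ℝ) else 0) (t := t) (d := d)
      (fun i hi => ih _ (by rw [card_insert_of_notMem (mem_compl.1 hi)]; omega))
    refine ⟨q + MvPolynomial.C ((t : ℝ) - #S)⁻¹ * ∏ i ∈ S, MvPolynomial.X i, b, ?_, fun T => ?_⟩
    · refine (MvPolynomial.totalDegree_add _ _).trans (max_le hq ?_)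
      refine (MvPolynomial.totalDegree_mul _ _).trans ?_
      rw [MvPolynomial.totalDegree_C, zero_add]
      exact (totalDegree_prod_X_le S).trans (by omega)
    · have key : ∑ i ∈ Sᶜ, (if insert i S ⊆ T then (1 : ℝ) else 0) =
          ((#T : ℝ) - #S) * if S ⊆ T then 1 else 0 := by
        by_cases hST : S ⊆ T
        · simp only [insert_subset_iff, hST, and_true, if_true, mul_one]
          rw [← Finset.sum_filter, sum_const, nsmul_eq_mul, mul_one,
            ← Nat.cast_sub (card_le_card hST), ← card_sdiff_of_subset hST]
          congr 2
          ext i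
          simp [and_comm]
        · simp [insert_subset_iff, hST]
      have h1 := hb T
      simp only at h1
      rw [← mul_sum, key] at h1
      rw [map_add, map_mul, MvPolynomial.eval_C, eval_prod_X_cubePoint]
      field_simp at h1 ⊢
      linear_combination h1

/-- A polynomial of degree at most `t ≤ n / 2` vanishing on the `t`-th level of the cube is
properly divisible by `t - ∑ xᵢ`. -/
lemma exists_level_cofactor {t d : ℕ} (hdt : d + 1 ≤ t) (htn : 2 * t ≤ n)
    (p : MvPolynomial (Fin n) ℝ) (hp : p.totalDegree ≤ d + 1)
    (hv : ∀ T : Finset (Fin n), #T = t → MvPolynomial.eval (cubePoint T) p = 0) :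
    ∃ q : MvPolynomial (Fin n) ℝ, q.totalDegree ≤ d ∧ ∀ T : Finset (Fin n),
      MvPolynomial.eval (cubePoint T) p =
        ((t : ℝ) - #T) * MvPolynomial.eval (cubePoint T) q := by
  obtain ⟨q, b, hq, hb⟩ := HasLevelReduction.sum p.support (fun m => p.coeff m)
    (fun m T => if m.support ⊆ T then (1 : ℝ) else 0) (t := t) (d := d)
    (fun m hm => hasLevelReduction_squarefree hdt (d + 1 - #m.support) _ (by
      have := card_support_le_totalDegree hm
      omega))
  simp only [← eval_cubePoint] at hb
  have hb0 := eq_zero_of_sum_powersetCard_eq_zero (d + 1) t univ b hdt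
    (by rw [card_univ, Fintype.card_fin]; omega) (fun T hT => by
      have hT := (mem_powersetCard.1 hT).2
      have := hb T
      rw [hv T hT, hT, sub_self, zero_mul, zero_add] at this
      exact this.symm)
  refine ⟨q, hq, fun T => ?_⟩
  rw [hb T, sum_eq_zero fun S hS => hb0 S (powersetCard_mono (subset_univ T) hS), add_zero]

lemma totalDegree_sum_sq_le {m d : ℕ} {g : Fin m → MvPolynomial (Fin n) ℝ}
    (hg : ∀ i, (g i).totalDegree ≤ d) : (∑ i, g i ^ 2).totalDegree ≤ 2 * d :=
  MvPolynomial.totalDegree_finsetSum_le fun i _ =>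
    (MvPolynomial.totalDegree_pow _ _).trans (Nat.mul_le_mul_left 2 (hg i))

lemma choose_cast_ne_zero {k : ℕ} (hk : k ≤ n) : ((n.choose k : ℕ) : ℝ) ≠ 0 := by
  have := Nat.choose_pos hk
  positivity

/-- The level means of a sum of squares of degree at most `t ≤ n / 2` vanish at `t` to even
order. -/
lemma even_rootMultiplicity_of_sos {t : ℕ} (htn : 2 * t ≤ n) (d : ℕ) :
    ∀ (m : ℕ) (g : Fin m → MvPolynomial (Fin n) ℝ) (P : ℝ[X]), d ≤ t →
      (∀ i, (g i).totalDegree ≤ d) → P.natDegree ≤ 2 * d →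
      (∀ k ≤ n, ∑ T ∈ powersetCard k univ, ∑ i, MvPolynomial.eval (cubePoint T) (g i) ^ 2 =
        n.choose k * P.eval (k : ℝ)) →
      P ≠ 0 → Even (P.rootMultiplicity (t : ℝ)) := by
  induction d with
  | zero =>
    intro m g P _ _ hP _ hP0
    rw [rootMultiplicity_eq_zero]
    · exact Even.zero
    · intro h
      rw [eq_C_of_natDegree_le_zero hP, IsRoot.def, eval_C] at h
      rw [eq_C_of_natDegree_le_zero hP, h, C_0] at hP0
      exact hP0 rfl
  | succ d ih =>
    intro m g P hdt hg hP hsum hP0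
    by_cases hroot : P.IsRoot (t : ℝ)
    swap
    · rw [rootMultiplicity_eq_zero hroot]
      exact Even.zero
    have hz : ∀ i, ∀ T : Finset (Fin n), #T = t →
        MvPolynomial.eval (cubePoint T) (g i) = 0 := by
      intro i T hT
      have h := hsum t (by omega)
      rw [hroot.eq_zero, mul_zero,
        sum_eq_zero_iff_of_nonneg fun T _ => sum_nonneg fun i _ => sq_nonneg _] at h
      have h1 := h T (mem_powersetCard.2 ⟨subset_univ T, hT⟩)
      rw [sum_eq_zero_iff_of_nonneg fun i _ => sq_nonneg _] at h1
      exact pow_eq_zero_iff two_ne_zero |>.1 (h1 i (mem_univ i))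
    choose q hq hgq using fun i => exists_level_cofactor hdt htn (g i) (hg i) (hz i)
    obtain ⟨P', hP', hsum'⟩ := exists_levelMean (∑ i, q i ^ 2)
    replace hP' := hP'.trans (totalDegree_sum_sq_le hq)
    simp only [map_sum, map_pow] at hsum'
    have hPP : P = (X - C (t : ℝ)) ^ 2 * P' := by
      refine eq_of_eval_levels (n := n) (by omega) ?_ fun k hk => ?_
      · refine natDegree_mul_le.trans ?_
        rw [natDegree_pow, natDegree_X_sub_C]
        omega
      · refine mul_left_cancel₀ (choose_cast_ne_zero hk) ?_
        rw [← hsum k hk]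
        simp only [eval_mul, eval_pow, eval_sub, eval_X, eval_C]
        rw [mul_left_comm, ← hsum' k, mul_sum]
        refine sum_congr rfl fun T hT => ?_
        rw [mul_sum]
        refine sum_congr rfl fun i _ => ?_
        rw [hgq, (mem_powersetCard.1 hT).2]
        ring
    have hP0' : P' ≠ 0 := fun h => hP0 (by rw [hPP, h, mul_zero])
    rw [hPP, rootMultiplicity_mul (hPP ▸ hP0), rootMultiplicity_X_sub_C_pow]
    exact even_two.add (ih m q P' (by omega) hq hP' (fun k _ => hsum' k) hP0')

lemma exists_polynomial_on_cube (φ : (Fin n → ℝ) → ℝ) :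
    ∃ p : MvPolynomial (Fin n) ℝ, ∀ x ∈ cube n, MvPolynomial.eval x p = φ x := by
  refine ⟨∑ T : Finset (Fin n), MvPolynomial.C (φ (cubePoint T)) *
    ∏ i, if i ∈ T then MvPolynomial.X i else 1 - MvPolynomial.X i, fun x hx => ?_⟩
  obtain ⟨U, rfl⟩ := exists_eq_cubePoint hx
  rw [map_sum, sum_eq_single U]
  · rw [map_mul, MvPolynomial.eval_C, map_prod, prod_eq_one, mul_one]
    intro i _
    by_cases h : i ∈ U <;> simp [h, cubePoint]
  · intro T _ hTU
    obtain ⟨i, hi⟩ : ∃ i, ¬ (i ∈ T ↔ i ∈ U) := by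
      by_contra! h
      exact hTU (Finset.ext h)
    rw [map_mul, map_prod, prod_eq_zero (mem_univ i), mul_zero]
    by_cases h1 : i ∈ T <;> by_cases h2 : i ∈ U <;> simp_all [cubePoint]
  · simp

lemma exists_totalDegree_le_degOn (φ : (Fin n → ℝ) → ℝ) :
    ∃ p : MvPolynomial (Fin n) ℝ, p.totalDegree ≤ degOn n (cube n) φ ∧
      ∀ x ∈ cube n, MvPolynomial.eval x p = φ x := by
  obtain ⟨p, hp⟩ := exists_polynomial_on_cube φ
  exact Nat.sInf_mem (s := {d | ∃ p : MvPolynomial (Fin n) ℝ, p.totalDegree ≤ d ∧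
    ∀ x ∈ cube n, MvPolynomial.eval x p = φ x}) ⟨p.totalDegree, p, le_rfl, hp⟩

lemma degOn_le_natDegree {φ : (Fin n → ℝ) → ℝ} (G : ℝ[X])
    (h : ∀ x ∈ cube n, φ x = G.eval (∑ i, x i)) : degOn n (cube n) φ ≤ G.natDegree := by
  refine Nat.sInf_le ⟨∑ j ∈ range (G.natDegree + 1), MvPolynomial.C (G.coeff j) *
    (∑ i, MvPolynomial.X i) ^ j, MvPolynomial.totalDegree_finsetSum_le fun j hj => ?_,
    fun x hx => ?_⟩
  · refine (MvPolynomial.totalDegree_mul _ _).trans ?_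
    rw [MvPolynomial.totalDegree_C, zero_add]
    refine (MvPolynomial.totalDegree_pow _ _).trans ?_
    have h1 : (∑ i, (MvPolynomial.X i : MvPolynomial (Fin n) ℝ)).totalDegree ≤ 1 :=
      MvPolynomial.totalDegree_finsetSum_le fun i _ => (MvPolynomial.totalDegree_X i).le
    have h2 := mem_range.1 hj
    nlinarith
  · rw [h x hx, eval_eq_sum_range]
    simp

/-- A function that only depends on the level is a univariate polynomial in the level. -/
lemma exists_eval_level {φ : (Fin n → ℝ) → ℝ} {a : ℕ → ℝ}
    (h : ∀ T : Finset (Fin n), φ (cubePoint T) = a #T) :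
    ∃ P : ℝ[X], P.natDegree ≤ degOn n (cube n) φ ∧ ∀ k ≤ n, a k = P.eval (k : ℝ) := by
  obtain ⟨p, hp, hpφ⟩ := exists_totalDegree_le_degOn φ
  obtain ⟨P, hP, hsum⟩ := exists_levelMean p
  refine ⟨P, hP.trans hp, fun k hk => ?_⟩
  refine mul_left_cancel₀ (choose_cast_ne_zero hk) ?_
  rw [← hsum k, sum_congr rfl fun T hT => by
    rw [hpφ _ (cubePoint_mem_cube T), h T, (mem_powersetCard.1 hT).2]]
  simp

lemma degOn_eq_natDegree {φ : (Fin n → ℝ) → ℝ} {G : ℝ[X]} (hG : G.natDegree ≤ n)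
    (h : ∀ x ∈ cube n, φ x = G.eval (∑ i, x i)) : degOn n (cube n) φ = G.natDegree := by
  have hle := degOn_le_natDegree G h
  obtain ⟨P, hP, hPk⟩ := exists_eval_level (φ := φ) (a := fun k => G.eval (k : ℝ))
    (fun T => by rw [h _ (cubePoint_mem_cube T), sum_cubePoint])
  have : G = P := eq_of_eval_levels hG (hP.trans (hle.trans hG)) hPk
  exact le_antisymm hle (this ▸ hP)

lemma SymmOn.eq_of_card_eq {f : (Fin n → ℝ) → ℝ} (hf : SymmOn n (cube n) f)
    {S T : Finset (Fin n)} (h : #S = #T) : f (cubePoint S) = f (cubePoint T) := by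
  let e : {i // i ∈ S} ≃ {i // i ∈ T} := Finset.equivOfCardEq h
  rw [← hf e.extendSubtype (cubePoint T) (cubePoint_mem_cube T)]
  congr 1
  funext i
  by_cases hi : i ∈ S
  · simp [cubePoint, hi, e.extendSubtype_mem i hi]
  · simp [cubePoint, hi, e.extendSubtype_not_mem i hi]

lemma SymmOn.exists_eval_level {f : (Fin n → ℝ) → ℝ} (hf : SymmOn n (cube n) f) :
    ∃ F : ℝ[X], F.natDegree ≤ degOn n (cube n) f ∧
      ∀ T : Finset (Fin n), f (cubePoint T) = F.eval (#T : ℝ) := by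
  have hex : ∀ k ≤ n, ∃ T : Finset (Fin n), #T = k := fun k hk => by
    obtain ⟨T, -, hT⟩ := exists_subset_card_eq (s := (univ : Finset (Fin n))) (n := k) (by simpa)
    exact ⟨T, hT⟩
  choose! U hU using hex
  have hfU : ∀ T : Finset (Fin n), f (cubePoint T) = f (cubePoint (U #T)) := fun T =>
    hf.eq_of_card_eq (hU _ (card_finset_fin_le T)).symm
  obtain ⟨F, hF, hk⟩ := _root_.exists_eval_level (a := fun k => f (cubePoint (U k))) hfU
  exact ⟨F, hF, fun T => (hfU T).trans (hk _ (card_finset_fin_le T))⟩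

end Cube

section LevelPower

variable {n t c : ℕ}

lemma card_roots_toFinset_le_iterate_derivative (p : ℝ[X]) (k : ℕ) :
    #p.roots.toFinset ≤ #(derivative^[k] p).roots.toFinset + k := by
  induction k with
  | zero => simp
  | succ k ih =>
    rw [Function.iterate_succ_apply']
    have := card_roots_toFinset_le_derivative (derivative^[k] p)
    omega

/-- A polynomial of degree below `c` agrees with `(t - x) ^ c` at no more than two points more
than its degree. -/
lemma le_natDegree_of_eval_eq_pow (hodd : Odd c) {G : ℝ[X]} (hGc : G.natDegree < c)
    (hG : ∀ k ≤ n, ((t : ℝ) - (k : ℝ)) ^ c = G.eval (k : ℝ)) : n ≤ G.natDegree + 1 := by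
  set p : ℝ[X] := (X - C (t : ℝ)) ^ c + G with hp
  have hX : ((X - C (t : ℝ)) ^ c).natDegree = c := by rw [natDegree_pow, natDegree_X_sub_C, mul_one]
  have hp0 : p ≠ 0 := by
    intro h
    have h1 := natDegree_add_eq_left_of_natDegree_lt (p := (X - C (t : ℝ)) ^ c) (q := G)
      (by rw [hX]; exact hGc)
    rw [← hp, h, hX, natDegree_zero] at h1
    omega
  have hroots : (range (n + 1)).image (fun k : ℕ => (k : ℝ)) ⊆ p.roots.toFinset := by
    intro x hx
    obtain ⟨k, hk, rfl⟩ := mem_image.1 hx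
    rw [Multiset.mem_toFinset, mem_roots hp0, IsRoot.def, hp, eval_add,
      ← hG k (Nat.lt_succ_iff.1 (mem_range.1 hk)), ← neg_sub (k : ℝ), hodd.neg_pow]
    simp
  have hcard := card_le_card hroots
  rw [card_image_of_injective _ Nat.cast_injective, card_range] at hcard
  have h1 := card_roots_toFinset_le_iterate_derivative p (G.natDegree + 1)
  have h2 : #(derivative^[G.natDegree + 1] p).roots.toFinset ≤ 1 := by
    rw [hp, iterate_map_add, iterate_derivative_eq_zero (Nat.lt_succ_self _), add_zero,
      iterate_derivative_X_sub_pow, ← Nat.cast_smul_eq_nsmul ℝ,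
      roots_smul_nonzero _ (by exact_mod_cast (Nat.descFactorial_pos.2 hGc).ne'), roots_pow,
      roots_X_sub_C]
    refine (card_le_card (t := {(t : ℝ)}) fun x hx => ?_).trans (card_singleton _).le
    have := Multiset.mem_of_mem_nsmul (Multiset.mem_toFinset.1 hx)
    simpa using this
  omega

lemma natDegree_C_sub_X_pow (a : ℝ) (c : ℕ) : ((C a - X) ^ c : ℝ[X]).natDegree = c := by
  rw [natDegree_pow, ← neg_sub X, natDegree_neg, natDegree_X_sub_C, mul_one]

/-- If the level polynomial `t - ∑ xᵢ` properly divides a symmetric function to odd order, then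
the univariate polynomial describing that function vanishes at `t` to odd order. -/
lemma odd_rootMultiplicity_of_properlyDividesOn (ht : 2 * t ≤ n) {f : (Fin n → ℝ) → ℝ}
    (hdf : degOn n (cube n) f ≤ t) (hodd : Odd c)
    (hdiv : ProperlyDividesOn n (cube n) (fun x => ((t : ℝ) - ∑ i, x i) ^ c) f)
    (hndiv : ¬ ProperlyDividesOn n (cube n) (fun x => ((t : ℝ) - ∑ i, x i) ^ (c + 1)) f)
    {F : ℝ[X]} (hF : F.natDegree ≤ degOn n (cube n) f)
    (hfF : ∀ T : Finset (Fin n), f (cubePoint T) = F.eval (#T : ℝ)) :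
    F ≠ 0 ∧ Odd (F.rootMultiplicity (t : ℝ)) := by
  obtain ⟨u, hu, hdeg⟩ := hdiv
  have hfF' : ∀ x ∈ cube n, f x = F.eval (∑ i, x i) := fun x hx => by
    obtain ⟨T, rfl⟩ := exists_eq_cubePoint hx
    rw [hfF, sum_cubePoint]
  obtain ⟨G, hG, hGk⟩ := exists_eval_level (n := n)
    (φ := fun x => ((t : ℝ) - ∑ i, x i) ^ c) (a := fun k => ((t : ℝ) - (k : ℝ)) ^ c)
    (fun T => by simp only [sum_cubePoint])
  have hc0 : c ≠ 0 := hodd.pos.ne'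
  have hF0 : F ≠ 0 := by
    intro hF0
    have hf0 : degOn n (cube n) f = 0 := by
      have := degOn_le_natDegree F hfF'
      rw [hF0, natDegree_zero] at this
      omega
    have hGC := eq_C_of_natDegree_le_zero (hG.trans (by omega : _ ≤ 0))
    have h1 := hGk t (by omega)
    have h2 := hGk 0 (by omega)
    rw [hGC, eval_C] at h1 h2
    simp only [sub_self, zero_pow hc0] at h1
    rw [← h1] at h2
    have ht0 : t = 0 := by simpa using pow_eq_zero_iff hc0 |>.1 h2
    subst ht0
    have hn0 : n = 0 := by
      by_contra hn
      have h3 := hGk 1 (by omega)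
      rw [hGC, eval_C, ← h1] at h3
      simpa using pow_eq_zero_iff hc0 |>.1 h3
    subst hn0
    have h3 : degOn 0 (cube 0) (fun x => (((0 : ℕ) : ℝ) - ∑ i, x i) ^ (c + 1)) = 0 :=
      Nat.le_zero.1 ((degOn_le_natDegree 0 (by simp)).trans natDegree_zero.le)
    have h4 : degOn 0 (cube 0) (fun _ => 0) = 0 :=
      Nat.le_zero.1 ((degOn_le_natDegree 0 (by simp)).trans natDegree_zero.le)
    exact hndiv ⟨fun _ => 0, fun x hx => by simp [hfF' x hx, hF0], by rw [hf0, h3, h4]⟩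
  refine ⟨hF0, ?_⟩
  have hroot : F.IsRoot (t : ℝ) := by
    obtain ⟨T, -, hT⟩ := exists_subset_card_eq (s := (univ : Finset (Fin n))) (n := t)
      (by rw [card_univ, Fintype.card_fin]; omega)
    have := hu _ (cubePoint_mem_cube T)
    simp only [sum_cubePoint, hT, sub_self, zero_pow hc0, zero_mul, hfF] at this
    exact this
  have hdvd := pow_rootMultiplicity_dvd F (t : ℝ)
  by_cases hcn : c ≤ n
  · have hdc : degOn n (cube n) (fun x => ((t : ℝ) - ∑ i, x i) ^ c) = c := by
      have h := degOn_eq_natDegree (n := n) (G := (C (t : ℝ) - X) ^ c)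
        (φ := fun x => ((t : ℝ) - ∑ i, x i) ^ c)
        ((natDegree_C_sub_X_pow _ _).trans_le hcn) (fun x _ => by simp)
      rwa [natDegree_C_sub_X_pow] at h
    obtain ⟨p, hp, hpu⟩ := exists_totalDegree_le_degOn u
    obtain ⟨V, hV, hVk⟩ := exists_levelMean p
    have hFV : F = (C (t : ℝ) - X) ^ c * V := by
      refine eq_of_eval_levels (n := n) (by omega) ?_ fun k hk => ?_
      · refine natDegree_mul_le.trans ?_
        rw [natDegree_C_sub_X_pow]
        omega
      · refine mul_left_cancel₀ (choose_cast_ne_zero hk) ?_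
        rw [eval_mul, mul_left_comm, ← hVk k, mul_sum, sum_congr rfl fun T hT => by
          rw [hpu _ (cubePoint_mem_cube T), eval_pow, eval_sub, eval_C, eval_X,
            ← (mem_powersetCard.1 hT).2, ← sum_cubePoint, ← hu _ (cubePoint_mem_cube T), hfF,
            (mem_powersetCard.1 hT).2]]
        simp
    have hle : c ≤ F.rootMultiplicity (t : ℝ) := by
      rw [le_rootMultiplicity_iff hF0, hFV, ← neg_sub X, hodd.neg_pow, neg_mul]
      exact (dvd_mul_right _ _).neg_right
    have hge : F.rootMultiplicity (t : ℝ) ≤ c := by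
      by_contra! hlt
      obtain ⟨W, hW⟩ := (pow_dvd_pow (X - C (t : ℝ)) hlt).trans hdvd
      have hev : Even (c + 1) := hodd.add_one
      rw [← neg_sub (C (t : ℝ)), hev.neg_pow] at hW
      have hW0 : W ≠ 0 := fun h => hF0 (by rw [hW, h, mul_zero])
      have hFdeg : F.natDegree = c + 1 + W.natDegree := by
        rw [hW, natDegree_mul (left_ne_zero_of_mul (hW ▸ hF0)) hW0, natDegree_C_sub_X_pow]
      have hd1 : degOn n (cube n) (fun x => ((t : ℝ) - ∑ i, x i) ^ (c + 1)) = c + 1 := by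
        have h := degOn_eq_natDegree (n := n) (G := (C (t : ℝ) - X) ^ (c + 1))
          (φ := fun x => ((t : ℝ) - ∑ i, x i) ^ (c + 1))
          ((natDegree_C_sub_X_pow _ _).trans_le (by omega)) (fun x _ => by simp)
        rwa [natDegree_C_sub_X_pow] at h
      have hd2 : degOn n (cube n) (fun x => W.eval (∑ i, x i)) = W.natDegree :=
        degOn_eq_natDegree (by omega) fun _ _ => rfl
      have hd3 : degOn n (cube n) f = F.natDegree := degOn_eq_natDegree (by omega) hfF'
      exact hndiv ⟨fun x => W.eval (∑ i, x i), fun x hx => by simp [hfF' x hx, hW],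
        by rw [hd1, hd2, hd3, hFdeg]⟩
    rwa [le_antisymm hge hle]
  · have hn := le_natDegree_of_eval_eq_pow hodd (by omega) hGk
    have h1 := (rootMultiplicity_pos hF0).2 hroot
    have h2 := natDegree_le_of_dvd hdvd hF0
    rw [natDegree_pow, natDegree_X_sub_C, mul_one] at h2
    rw [show F.rootMultiplicity (t : ℝ) = 1 by omega]
    exact odd_one

end LevelPower

theorem stmt6 (n t : ℕ) (ht : 2 * t ≤ n)
    (f : (Fin n → ℝ) → ℝ) (hsym : SymmOn n (cube n) f)
    (hdf : degOn n (cube n) f ≤ t)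
    (c : ℕ) (hodd : Odd c)
    (hdiv : ProperlyDividesOn n (cube n) (fun x => ((t : ℝ) - ∑ i, x i) ^ c) f)
    (hndiv : ¬ ProperlyDividesOn n (cube n) (fun x => ((t : ℝ) - ∑ i, x i) ^ (c + 1)) f)
    (d₁ d₂ : ℕ) (hd₁ : 2 * d₁ ≤ n - degOn n (cube n) f) (hd₁' : d₁ ≤ t) (hd₂ : d₂ ≤ t) :
    ¬ ∃ h : (Fin n → ℝ) → ℝ, IsSosOn n (cube n) d₁ h ∧ (∃ x ∈ cube n, h x ≠ 0) ∧
      IsSosOn n (cube n) d₂ (fun x => f x * h x) := by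
  rintro ⟨h, ⟨m₁, g, hg, hgh⟩, ⟨x, hx, hhx⟩, ⟨m₂, q, hq, hqf⟩⟩
  obtain ⟨F, hF, hfF⟩ := hsym.exists_eval_level
  obtain ⟨hF0, hFodd⟩ :=
    odd_rootMultiplicity_of_properlyDividesOn ht hdf hodd hdiv hndiv hF hfF
  obtain ⟨H, hH, hHk⟩ := exists_levelMean (∑ i, g i ^ 2)
  obtain ⟨Q, hQ, hQk⟩ := exists_levelMean (∑ i, q i ^ 2)
  replace hH := hH.trans (totalDegree_sum_sq_le hg)
  replace hQ := hQ.trans (totalDegree_sum_sq_le hq)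
  simp only [map_sum, map_pow] at hHk hQk
  have hFH : F * H = Q := by
    refine eq_of_eval_levels (n := n) (natDegree_mul_le.trans (by omega)) (by omega)
      fun k hk => ?_
    refine mul_left_cancel₀ (choose_cast_ne_zero hk) ?_
    rw [eval_mul, mul_left_comm, ← hHk k, ← hQk k, mul_sum]
    refine sum_congr rfl fun T hT => ?_
    rw [← hqf _ (cubePoint_mem_cube T), ← hgh _ (cubePoint_mem_cube T),
      ← (mem_powersetCard.1 hT).2, ← hfF]
  have hH0 : H ≠ 0 := by
    rintro rfl
    obtain ⟨T, rfl⟩ := exists_eq_cubePoint hx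
    have h0 := hHk #T
    rw [eval_zero, mul_zero, sum_eq_zero_iff_of_nonneg fun T _ => sum_nonneg fun i _ =>
      sq_nonneg _] at h0
    exact hhx ((hgh _ hx).trans (h0 T (mem_powersetCard.2 ⟨subset_univ T, rfl⟩)))
  have hQ0 : F * H ≠ 0 := mul_ne_zero hF0 hH0
  have hHeven := even_rootMultiplicity_of_sos ht d₁ m₁ g H hd₁' hg hH (fun k _ => hHk k) hH0
  have hQeven := even_rootMultiplicity_of_sos ht d₂ m₂ q Q hd₂ hq hQ (fun k _ => hQk k)
    (hFH ▸ hQ0)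
  rw [← hFH, rootMultiplicity_mul hQ0] at hQeven
  exact Nat.not_even_iff_odd.2 (hFodd.add_even hHeven) hQeven
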